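/- arXiv:2107.13809 — 5 statements merged into one kernel-verified Lean document; each statement's English description precedes it below -/
import Mathlib

section
/- Let ∗ ∈ {01, ⋆, ∅} and let σ be a signature. For every ∗-structure A over σ there exists a ∗-structure C over σ such that: (i) C is a core, i.e. every homomorphism C → C is an isomorphism; (ii) there are homomorphisms A → C and C → A; (iii) C is isomorphic to an induced substructure of A. Moreover C is unique up to isomorphism: any two cores that are homomorphically equivalent to A are isomorphic. -/
/-- The four possible values of a `∅`-structure: `∅`, `0`, `1`, `⋆`. -/
inductive MPV : Type
  | emp : MPV
  | zero : MPV
  | one : MPV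
  | star : MPV
  deriving DecidableEq

/-- The partial order `≼_∅` on `{∅,0,1,⋆}`: `∅ ≼ 0 ≼ ⋆`, `∅ ≼ 1 ≼ ⋆`, with `0,1` incomparable.
Restricted to `{0,1,⋆}` it is `≼_⋆`, and restricted to `{0,1}` it is the empty (discrete)
order `≼_01`. -/
def MPV.le : MPV → MPV → Prop := fun a b => a = b ∨ a = MPV.emp ∨ b = MPV.star

instance (a b : MPV) : Decidable (MPV.le a b) := by
  unfold MPV.le; infer_instance

/-- A `(P_∅, σ)`-structure, where the signature `σ` has symbols indexed by `ι`,
the symbol `i` having arity `ar i`. -/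
structure MPStruct (ι : Type) (ar : ι → ℕ) : Type 1 where
  carrier : Type
  [finCarrier : Fintype carrier]
  rel : ∀ i : ι, (Fin (ar i) → carrier) → MPV

attribute [instance] MPStruct.finCarrier

variable {ι : Type} {ar : ι → ℕ}

/-- `h` is a homomorphism from `G` to `H`. -/
def IsHom (G H : MPStruct ι ar) (h : G.carrier → H.carrier) : Prop :=
  ∀ (i : ι) (t : Fin (ar i) → G.carrier), MPV.le (G.rel i t) (H.rel i (h ∘ t))

/-- There exists a homomorphism from `G` to `H`. -/
def Hom (G H : MPStruct ι ar) : Prop := ∃ h, IsHom G H h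

/-- `h` is an isomorphism from `G` to `H`. -/
def IsIsoMap (G H : MPStruct ι ar) (h : G.carrier → H.carrier) : Prop :=
  Function.Bijective h ∧
    ∀ (i : ι) (t : Fin (ar i) → G.carrier), H.rel i (h ∘ t) = G.rel i t

/-- `G` and `H` are isomorphic. -/
def Iso (G H : MPStruct ι ar) : Prop := ∃ h, IsIsoMap G H h

/-- `G` is a core: every endo-homomorphism is an isomorphism. -/
def IsCore (G : MPStruct ι ar) : Prop := ∀ h, IsHom G G h → IsIsoMap G G h

/-- `G` is a `01`-structure: all values are in `{0,1}`. -/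
def MPStruct.is01 (G : MPStruct ι ar) : Prop :=
  ∀ (i : ι) (t : Fin (ar i) → G.carrier),
    G.rel i t = MPV.zero ∨ G.rel i t = MPV.one

/-- `G` is a `⋆`-structure: all values are in `{0,1,⋆}`. -/
def MPStruct.isStar (G : MPStruct ι ar) : Prop :=
  ∀ (i : ι) (t : Fin (ar i) → G.carrier), G.rel i t ≠ MPV.emp

/-- The induced substructure `G ∖ {v}`. -/
noncomputable def MPStruct.delete (G : MPStruct ι ar) (v : G.carrier) :
    MPStruct ι ar where
  carrier := {x : G.carrier // x ≠ v}
  finCarrier := by classical exact inferInstance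
  rel := fun i t => G.rel i fun j => (t j).1

/-- `G` is an inclusion-minimal obstruction for `MP_P(H)`, where `P` cuts out the class of
input structures (`01`-, `⋆`- or `∅`-structures). -/
def InclMinObs (P : MPStruct ι ar → Prop) (H G : MPStruct ι ar) : Prop :=
  P G ∧ ¬ Hom G H ∧ ∀ v : G.carrier, Hom (G.delete v) H

/-- `G` is a hom-minimal obstruction for `MP_P(H)`. -/
def HomMinObs (P : MPStruct ι ar → Prop) (H G : MPStruct ι ar) : Prop :=
  P G ∧ IsCore G ∧ ¬ Hom G H ∧
    ∀ G' : MPStruct ι ar, P G' → Hom G' G → ¬ Hom G G' → Hom G' H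

/-- The class `S` contains only finitely many isomorphism classes. -/
def FinitelyManyUpToIso (S : MPStruct ι ar → Prop) : Prop :=
  ∃ L : List (MPStruct ι ar), ∀ G, S G → ∃ G' ∈ L, Iso G G'

/-- The three classes of structures `01` (`s = 0`), `⋆` (`s = 1`) and `∅` (`s = 2`). -/
def ClassPred (s : Fin 3) : MPStruct ι ar → Prop :=
  if s = 0 then MPStruct.is01 else if s = 1 then MPStruct.isStar else fun _ => True

/-- `h` embeds `G` into `H` as an induced substructure, i.e. `G` is isomorphic (via `h`)
to the induced substructure of `H` on the image of `h`. -/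
def IsEmbedding (G H : MPStruct ι ar) (h : G.carrier → H.carrier) : Prop :=
  Function.Injective h ∧
    ∀ (i : ι) (t : Fin (ar i) → G.carrier), H.rel i (h ∘ t) = G.rel i t

theorem MPV.le_refl (a : MPV) : MPV.le a a := Or.inl rfl

theorem MPV.le_trans {a b c : MPV} (hab : MPV.le a b) (hbc : MPV.le b c) : MPV.le a c := by
  cases a <;> cases b <;> cases c <;> simp_all [MPV.le]

theorem MPV.le_antisymm {a b : MPV} (hab : MPV.le a b) (hba : MPV.le b a) : a = b := by
  cases a <;> cases b <;> simp_all [MPV.le]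

theorem IsHom.comp {G H K : MPStruct ι ar} {g : H.carrier → K.carrier}
    {f : G.carrier → H.carrier} (hg : IsHom H K g) (hf : IsHom G H f) : IsHom G K (g ∘ f) :=
  fun i t => MPV.le_trans (hf i t) (hg i (f ∘ t))

theorem IsEmbedding.isHom {G H : MPStruct ι ar} {e : G.carrier → H.carrier}
    (he : IsEmbedding G H e) : IsHom G H e :=
  fun i t => Or.inl (he.2 i t).symm

theorem IsHom.iterate_le {G : MPStruct ι ar} {h : G.carrier → G.carrier} (hh : IsHom G G h)
    (i : ι) (n : ℕ) (t : Fin (ar i) → G.carrier) :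
    MPV.le (G.rel i t) (G.rel i ((h ∘ ·)^[n] t)) := by
  induction n generalizing t with
  | zero => exact MPV.le_refl _
  | succ n ih => exact MPV.le_trans (hh i t) (ih (h ∘ t))

/-- A surjective endomorphism of a finite structure is an automorphism. -/
theorem IsHom.isIsoMap_of_surjective {G : MPStruct ι ar} {h : G.carrier → G.carrier}
    (hh : IsHom G G h) (hs : Function.Surjective h) : IsIsoMap G G h := by
  have hi : Function.Injective h := Finite.injective_iff_surjective.2 hs
  refine ⟨⟨hi, hs⟩, fun i t => ?_⟩
  obtain ⟨n, hn, ht⟩ := hi.comp_left.mem_periodicPts t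
  obtain ⟨m, rfl⟩ := Nat.exists_eq_succ_of_ne_zero hn.ne'
  have hle := hh.iterate_le i m (h ∘ t)
  rw [← Function.iterate_succ_apply (h ∘ ·), ht] at hle
  exact MPV.le_antisymm hle (hh i t)

/-- Homomorphically equivalent cores are isomorphic. -/
theorem IsCore.iso {G H : MPStruct ι ar} (hG : IsCore G) (hH : IsCore H)
    (hGH : Hom G H) (hHG : Hom H G) : Iso G H := by
  obtain ⟨f, hf⟩ := hGH
  obtain ⟨g, hg⟩ := hHG
  have hgf := hG _ (hg.comp hf)
  have hfg := hH _ (hf.comp hg)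
  refine ⟨f, ⟨hgf.1.1.of_comp, hfg.1.2.of_comp⟩, fun i t => ?_⟩
  have hle := hg i (f ∘ t)
  rw [← Function.comp_assoc, hgf.2 i t] at hle
  exact MPV.le_antisymm hle (hf i t)

/-- The induced substructure of `G` on the subset `X`. -/
noncomputable def MPStruct.induced (G : MPStruct ι ar) (X : Set G.carrier) : MPStruct ι ar where
  carrier := X
  finCarrier := Fintype.ofFinite X
  rel := fun i t => G.rel i (Subtype.val ∘ t)

theorem MPStruct.isEmbedding_induced (G : MPStruct ι ar) (X : Set G.carrier) :
    IsEmbedding (G.induced X) G Subtype.val :=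
  ⟨Subtype.val_injective, fun _ _ => rfl⟩

theorem IsHom.rangeFactorization {G : MPStruct ι ar} {h : G.carrier → G.carrier}
    (hh : IsHom G G h) : IsHom G (G.induced (Set.range h)) (Set.rangeFactorization h) :=
  hh

theorem ClassPred.of_isEmbedding {s : Fin 3} {G H : MPStruct ι ar} {e : G.carrier → H.carrier}
    (he : IsEmbedding G H e) (hH : ClassPred s H) : ClassPred s G := by
  unfold ClassPred at *
  split_ifs at * with h0 h1
  · exact fun i t => he.2 i t ▸ hH i (e ∘ t)
  · exact fun i t => he.2 i t ▸ hH i (e ∘ t)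
  · trivial

/-- The image of an endomorphism with smallest possible range is a core. -/
theorem IsHom.isCore_induced_range {G : MPStruct ι ar} {h : G.carrier → G.carrier}
    (hh : IsHom G G h)
    (hmin : ∀ k, IsHom G G k → (Set.range h).ncard ≤ (Set.range k).ncard) :
    IsCore (G.induced (Set.range h)) := by
  intro k hk
  refine hk.isIsoMap_of_surjective fun y => ?_
  have hsub : Set.range (Subtype.val ∘ k ∘ Set.rangeFactorization h) ⊆ Set.range h := by
    rintro _ ⟨x, rfl⟩
    exact (k (Set.rangeFactorization h x)).2
  have heq := Set.eq_of_subset_of_ncard_le hsub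
    (hmin _ ((G.isEmbedding_induced _).isHom.comp (hk.comp hh.rangeFactorization)))
  obtain ⟨x, hx⟩ := heq.ge y.2
  exact ⟨_, Subtype.ext hx⟩

/-- for `∗ ∈ {01, ⋆, ∅}` (encoded by `s : Fin 3`), every `∗`-structure `A`
has a core `C` which is homomorphically equivalent to `A` and embeds into `A` as an induced
substructure, and `C` is unique up to isomorphism among cores homomorphically
equivalent to `A`. -/
theorem core_exists_unique (s : Fin 3) (A : MPStruct ι ar) (hA : ClassPred s A) :
    ∃ C : MPStruct ι ar, ClassPred s C ∧ IsCore C ∧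
      Hom A C ∧ Hom C A ∧ (∃ e, IsEmbedding C A e) ∧
      ∀ C' : MPStruct ι ar, ClassPred s C' → IsCore C' → Hom A C' → Hom C' A →
        Iso C C' := by
  obtain ⟨h, hh, hmin⟩ := Set.exists_min_image {h | IsHom A A h}
    (fun h => (Set.range h).ncard) (Set.toFinite _) ⟨id, fun _ _ => MPV.le_refl _⟩
  have he := A.isEmbedding_induced (Set.range h)
  have hcore := IsHom.isCore_induced_range hh hmin
  refine ⟨A.induced (Set.range h), .of_isEmbedding he hA, hcore, ⟨_, IsHom.rangeFactorization hh⟩,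
    ⟨_, he.isHom⟩, ⟨_, he⟩, ?_⟩
  rintro C' - hC' ⟨f, hf⟩ ⟨g, hg⟩
  exact hcore.iso hC' ⟨_, hf.comp he.isHom⟩ ⟨_, (IsHom.rangeFactorization hh).comp hg⟩
end

section
/- Let H be an n × n Hadamard matrix whose rows and columns are indexed by [n] = {1,…,n}. Then for any two disjoint subsets A, B ⊆ [n] with |A| = |B| and |A| > √n, the submatrix H[A,B] = (H[i,j])_{i∈A, j∈B} is not monochromatic, i.e. its entries are not all equal. -/
/-- The column sums of `H` over a set of rows `A` have total square mass `|A| * n`. -/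
lemma sum_sq_column_sums {m k : Type*} [Fintype m] [DecidableEq k] (n : ℤ)
    (H : Matrix k m ℤ) (hH : H * H.transpose = n • (1 : Matrix k k ℤ)) (A : Finset k) :
    ∑ j, (∑ i ∈ A, H i j) ^ 2 = A.card * n := by
  have hrow (i i' : k) : ∑ j, H i j * H i' j = if i = i' then n else 0 := by
    simpa [Matrix.mul_apply, Matrix.one_apply] using congrFun (congrFun hH i) i'
  calc ∑ j, (∑ i ∈ A, H i j) ^ 2
      = ∑ j, ∑ i ∈ A, ∑ i' ∈ A, H i j * H i' j := by
        simp only [sq, Finset.sum_mul_sum]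
    _ = ∑ i ∈ A, ∑ i' ∈ A, ∑ j, H i j * H i' j := by
        rw [Finset.sum_comm]
        exact Finset.sum_congr rfl fun i _ => Finset.sum_comm
    _ = A.card * n := by simp [hrow]

/-- Lindsey's lemma, for submatrix sums of a matrix with orthogonal rows of square norm `n`. -/
lemma sq_sum_submatrix_le {m k : Type*} [Fintype m] [DecidableEq k] (n : ℤ)
    (H : Matrix k m ℤ) (hH : H * H.transpose = n • (1 : Matrix k k ℤ))
    (A : Finset k) (B : Finset m) :
    (∑ j ∈ B, ∑ i ∈ A, H i j) ^ 2 ≤ B.card * (A.card * n) := by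
  rw [← sum_sq_column_sums n H hH A]
  refine sq_sum_le_card_mul_sum_sq.trans (mul_le_mul_of_nonneg_left ?_ (by positivity))
  exact Finset.sum_le_sum_of_subset_of_nonneg (Finset.subset_univ B) fun _ _ _ => sq_nonneg _

/-- if `H` is an `n × n` Hadamard matrix and `A, B` are disjoint sets of
indices with `|A| = |B| > √n`, then the submatrix `H[A,B]` is not monochromatic. -/
theorem hadamard_not_monochromatic (n : ℕ) (H : Matrix (Fin n) (Fin n) ℤ)
    (hent : ∀ i j, H i j = 1 ∨ H i j = -1)
    (hHad : H * H.transpose = (n : ℤ) • (1 : Matrix (Fin n) (Fin n) ℤ))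
    (A B : Finset (Fin n)) (hdisj : Disjoint A B) (hcard : A.card = B.card)
    (hbig : Real.sqrt n < (A.card : ℝ)) :
    ¬ ∃ c : ℤ, ∀ i ∈ A, ∀ j ∈ B, H i j = c := by
  rintro ⟨c, hc⟩
  have hpos : 0 < A.card := by exact_mod_cast (Real.sqrt_nonneg _).trans_lt hbig
  have hlt : (n : ℤ) < (A.card : ℤ) ^ 2 := by
    exact_mod_cast (Real.sqrt_lt' (by exact_mod_cast hpos)).mp hbig
  obtain ⟨i, hi⟩ := Finset.card_pos.mp hpos
  obtain ⟨j, hj⟩ := Finset.card_pos.mp (hcard ▸ hpos)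
  have hc_sq : c ^ 2 = 1 := by
    rw [← hc i hi j hj]
    rcases hent i j with h | h <;> simp [h]
  have hsum : ∑ j ∈ B, ∑ i ∈ A, H i j = (A.card : ℤ) ^ 2 * c := by
    rw [Finset.sum_congr rfl fun j hj => Finset.sum_congr rfl fun i hi => hc i hi j hj]
    simp only [Finset.sum_const, nsmul_eq_mul, ← hcard]
    ring
  have hle := sq_sum_submatrix_le n H hHad A B
  rw [hsum, mul_pow, hc_sq, ← hcard] at hle
  have hsq : (0 : ℤ) < (A.card : ℤ) ^ 2 := by positivity
  nlinarith [mul_lt_mul_of_pos_left hlt hsq]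
end

section
/- Let σ₂ be the signature with one binary symbol E and let σ₃ = {R} with R ternary. For n ≥ 3, let g₂(n) be the number of isomorphism classes of ⋆-graphs on n elements that are cores and have no element x with E(x,x) = ⋆, and let g₃(n) be the number of isomorphism classes of (⋆,σ₃)-structures on n elements that are cores and have no element x with R(x,x,x) = ⋆. Then g₃(n) ≥ g₂(n) · 3^{n(n−1)² − 1}. -/
variable {ι : Type} {ar : ι → ℕ}

/-- The structure on domain `Fin n` over the one-symbol signature of arity `k`
with relation `f`. -/
def ofRel (n k : ℕ) (f : (Fin k → Fin n) → MPV) : MPStruct Unit (fun _ => k) where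
  carrier := Fin n
  rel := fun _ => f

/-- `⋆`-structures on `Fin n` over a single `k`-ary symbol that are cores and have no
element `x` whose diagonal tuple `(x,…,x)` has value `⋆`. -/
def CoreRels (n k : ℕ) : Type :=
  {f : (Fin k → Fin n) → MPV //
    (ofRel n k f).isStar ∧ IsCore (ofRel n k f) ∧
    ∀ x : Fin n, f (fun _ => x) ≠ MPV.star}

/-- The number of isomorphism classes of such structures; `gcount n 2` is `g₂(n)` and
`gcount n 3` is `g₃(n)`. -/
noncomputable def gcount (n k : ℕ) : ℕ :=
  Nat.card (Quot (fun a b : CoreRels n k => Iso (ofRel n k a.1) (ofRel n k b.1)))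

theorem Iso.refl (G : MPStruct ι ar) : Iso G G :=
  ⟨id, Function.bijective_id, fun _ _ => rfl⟩

theorem Iso.symm {G H : MPStruct ι ar} : Iso G H → Iso H G := by
  rintro ⟨h, hb, hh⟩
  let e := Equiv.ofBijective h hb
  refine ⟨e.symm, e.symm.bijective, fun i t => ?_⟩
  rw [← hh i (e.symm ∘ t)]
  congr 1
  funext j
  exact e.apply_symm_apply (t j)

theorem Iso.trans {G H K : MPStruct ι ar} : Iso G H → Iso H K → Iso G K := by
  rintro ⟨h, hb, hh⟩ ⟨k, kb, hk⟩
  exact ⟨k ∘ h, kb.comp hb, fun i t => (hk i (h ∘ t)).trans (hh i t)⟩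

theorem IsHom.iterate {G : MPStruct ι ar} {h : G.carrier → G.carrier} (hh : IsHom G G h)
    (m : ℕ) : IsHom G G (h^[m]) := by
  induction m with
  | zero => exact fun _ _ => MPV.le_refl _
  | succ m ih => exact fun i t => MPV.le_trans (hh i t) (ih i (h ∘ t))

/-- A bijective endomorphism of a finite structure is an isomorphism. -/
theorem IsHom.isIsoMap_of_bijective {G : MPStruct ι ar} {h : G.carrier → G.carrier}
    (hh : IsHom G G h) (hb : Function.Bijective h) : IsIsoMap G G h := by
  refine ⟨hb, fun i t => MPV.le_antisymm ?_ (hh i t)⟩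
  let e : Equiv.Perm G.carrier := Equiv.ofBijective h hb
  have hpos : 0 < orderOf e := orderOf_pos e
  have hid : ∀ x, h^[orderOf e - 1] (h x) = x := fun x => by
    rw [← Function.iterate_succ_apply, Nat.succ_eq_add_one, Nat.sub_add_cancel hpos]
    have := congrArg (fun f : Equiv.Perm G.carrier => f x) (pow_orderOf_eq_one e)
    rwa [Equiv.Perm.coe_pow] at this
  have key := hh.iterate (orderOf e - 1) i (h ∘ t)
  rwa [show h^[orderOf e - 1] ∘ (h ∘ t) = t from funext fun j => hid (t j)] at key

theorem coreRels_iso_equivalence (n k : ℕ) :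
    Equivalence (fun a b : CoreRels n k => Iso (ofRel n k a.1) (ofRel n k b.1)) :=
  ⟨fun _ => Iso.refl _, Iso.symm, Iso.trans⟩

instance : Finite MPV :=
  Finite.of_injective (fun a : MPV => (decide (a = .emp), decide (a = .zero), decide (a = .one)))
    (by intro a b; cases a <;> cases b <;> decide)

instance (n k : ℕ) : Finite (CoreRels n k) := by
  unfold CoreRels; infer_instance

/-- The non-empty values, indexed by `Fin 3`. -/
def MPV.ofFin : Fin 3 → MPV := ![MPV.zero, MPV.one, MPV.star]

theorem MPV.ofFin_injective : Function.Injective MPV.ofFin := by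
  unfold Function.Injective; decide

theorem MPV.ofFin_ne_emp (a : Fin 3) : MPV.ofFin a ≠ MPV.emp := by
  revert a; decide

/-- Fillings of the triples whose first two entries are distinct. -/
abbrev Filling (n : ℕ) : Type :=
  ((Finset.univ : Finset (Fin n)).offDiag × Fin n) → Fin 3

/-- The ternary relation with `R(x,x,y) = E(x,y)` and the other values prescribed by `w`. -/
def ternaryExtension {n : ℕ} (f : (Fin 2 → Fin n) → MPV) (w : Filling n) :
    (Fin 3 → Fin n) → MPV := fun t =>
  if h : t 0 = t 1 then f ![t 0, t 2]
  else MPV.ofFin (w (⟨(t 0, t 1), by simpa using h⟩, t 2))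

theorem ternaryExtension_diag {n : ℕ} (f : (Fin 2 → Fin n) → MPV) (w : Filling n)
    (x y : Fin n) : ternaryExtension f w ![x, x, y] = f ![x, y] := by
  simp [ternaryExtension]

theorem ternaryExtension_offDiag {n : ℕ} (f : (Fin 2 → Fin n) → MPV) (w : Filling n)
    (p : (Finset.univ : Finset (Fin n)).offDiag) (z : Fin n) :
    ternaryExtension f w ![p.1.1, p.1.2, z] = MPV.ofFin (w (p, z)) := by
  have h : p.1.1 ≠ p.1.2 := (Finset.mem_offDiag.1 p.2).2.2
  simp [ternaryExtension, h]

theorem ternaryExtension_injective {n : ℕ} {f g : (Fin 2 → Fin n) → MPV} {v w : Filling n}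
    (h : ternaryExtension f v = ternaryExtension g w) : f = g ∧ v = w := by
  constructor
  · funext t
    have := congrFun h ![t 0, t 0, t 1]
    rw [ternaryExtension_diag, ternaryExtension_diag] at this
    rwa [show ![t 0, t 1] = t by ext j; fin_cases j <;> rfl] at this
  · funext ⟨p, z⟩
    have := congrFun h ![p.1.1, p.1.2, z]
    rw [ternaryExtension_offDiag, ternaryExtension_offDiag] at this
    exact MPV.ofFin_injective this

theorem isHom_of_isHom_ternaryExtension {n : ℕ} {f : (Fin 2 → Fin n) → MPV} {w : Filling n}
    {h : Fin n → Fin n}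
    (hh : IsHom (ofRel n 3 (ternaryExtension f w)) (ofRel n 3 (ternaryExtension f w)) h) :
    IsHom (ofRel n 2 f) (ofRel n 2 f) h := by
  intro i (t : Fin 2 → Fin n)
  have key : MPV.le (ternaryExtension f w ![t 0, t 0, t 1])
      (ternaryExtension f w (h ∘ ![t 0, t 0, t 1])) := hh i ![t 0, t 0, t 1]
  rw [show h ∘ ![t 0, t 0, t 1] = ![h (t 0), h (t 0), h (t 1)] by
      ext j; fin_cases j <;> rfl,
    ternaryExtension_diag, ternaryExtension_diag,
    show ![t 0, t 1] = t by ext j; fin_cases j <;> rfl,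
    show ![h (t 0), h (t 1)] = h ∘ t by ext j; fin_cases j <;> rfl] at key
  exact key

/-- Every ternary extension of a core is a core. -/
def CoreRels.extend {n : ℕ} (a : CoreRels n 2) (w : Filling n) : CoreRels n 3 :=
  ⟨ternaryExtension a.1 w, by
    obtain ⟨f, hstar, hcore, hloop⟩ := a
    refine ⟨fun i (t : Fin 3 → Fin n) => ?_, fun h hh => ?_, fun x => ?_⟩
    · change ternaryExtension f w t ≠ MPV.emp
      unfold ternaryExtension
      split_ifs
      · exact hstar () _
      · exact MPV.ofFin_ne_emp _
    · exact hh.isIsoMap_of_bijective (hcore h (isHom_of_isHom_ternaryExtension hh)).1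
    · have := hloop x
      rwa [← show ![x, x] = fun _ => x by ext j; fin_cases j <;> rfl,
        ← ternaryExtension_diag f w,
        show ![x, x, x] = fun _ => x by ext j; fin_cases j <;> rfl] at this⟩

theorem gcount_two_mul_le (n : ℕ) :
    gcount n 2 * 3 ^ ((n * n - n) * n) ≤ gcount n 3 * n.factorial := by
  let r := fun a b : CoreRels n 3 => Iso (ofRel n 3 a.1) (ofRel n 3 b.1)
  have hiso (q : Quot fun a b : CoreRels n 2 => Iso (ofRel n 2 a.1) (ofRel n 2 b.1))
      (w : Filling n) : ∃ e : Equiv.Perm (Fin n), ∀ t : Fin 3 → Fin n,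
        (q.out.extend w).1 (e ∘ t) = (Quot.mk r (q.out.extend w)).out.1 t := by
    obtain ⟨h, hb, hh⟩ : r (Quot.mk r (q.out.extend w)).out (q.out.extend w) :=
      (coreRels_iso_equivalence n 3).quot_mk_eq_iff _ _ |>.1 (Quot.out_eq _)
    exact ⟨Equiv.ofBijective h hb, hh ()⟩
  choose e he using hiso
  have hinj : Function.Injective fun p : _ × Filling n =>
      (Quot.mk r (p.1.out.extend p.2), e p.1 p.2) := by
    rintro ⟨q, v⟩ ⟨q', w⟩ h
    obtain ⟨h₁, h₂⟩ := Prod.mk.inj h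
    dsimp only at h₁ h₂
    have hrel : (q.out.extend v).1 = (q'.out.extend w).1 := by
      funext t
      have ht : t = e q v ∘ ((e q v).symm ∘ t) := by
        funext j; exact ((e q v).apply_symm_apply (t j)).symm
      rw [ht, he q v, h₁, h₂, he q' w]
    obtain ⟨hf, rfl⟩ := ternaryExtension_injective hrel
    rw [← Quot.out_eq q, ← Quot.out_eq q', Subtype.ext hf]
  have hcard := Nat.card_le_card_of_injective _ hinj
  rw [Nat.card_prod, Nat.card_prod, Nat.card_perm, Nat.card_fun] at hcard
  rw [Nat.card_prod, Nat.card_eq_fintype_card (α := Finset.offDiag _), Fintype.card_coe,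
    Finset.offDiag_card] at hcard
  simpa [gcount, r] using hcard

theorem factorial_succ_le_three_pow (m : ℕ) : (m + 1).factorial ≤ 3 ^ ((m + 1) * m) := by
  induction m with
  | zero => simp
  | succ m ih =>
    calc (m + 1 + 1).factorial = (m + 2) * (m + 1).factorial := Nat.factorial_succ _
      _ ≤ 3 ^ (m + 2) * 3 ^ ((m + 1) * m) :=
        Nat.mul_le_mul (Nat.lt_pow_self (by norm_num)).le ih
      _ ≤ 3 ^ ((m + 1 + 1) * (m + 1)) := by
        rw [← pow_add]
        exact Nat.pow_le_pow_right (by norm_num) (by nlinarith)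

/-- for `n ≥ 3`, `g₃(n) ≥ g₂(n) · 3^{n(n-1)² - 1}`. -/
theorem ternary_core_count_lower_bound (n : ℕ) (hn : 3 ≤ n) :
    gcount n 2 * 3 ^ (n * (n - 1) ^ 2 - 1) ≤ gcount n 3 := by
  obtain ⟨m, rfl⟩ : ∃ m, n = m + 1 := ⟨n - 1, by omega⟩
  have hexp : ((m + 1) * (m + 1) - (m + 1)) * (m + 1) = (m + 1) * m ^ 2 + (m + 1) * m := by
    rw [← Nat.mul_sub_one, Nat.add_sub_cancel]; ring
  have h := gcount_two_mul_le (m + 1)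
  rw [hexp, pow_add, ← mul_assoc] at h
  have h' := h.trans (Nat.mul_le_mul_left _ (factorial_succ_le_three_pow m))
  refine le_trans (Nat.mul_le_mul_left _ (Nat.pow_le_pow_right (by norm_num) ?_))
    (Nat.le_of_mul_le_mul_right h' (by positivity))
  exact Nat.sub_le _ _
end

section
/- With g₂ and g₃ as defined (numbers of isomorphism classes of n-element cores without ⋆-loop among ⋆-graphs, respectively among ternary ⋆-structures): for all integers n ≥ 3 and m ≥ 1, if g₃(n) < g₂(m), then m² > n(n−1)² − 1. -/
variable {ι : Type} {ar : ι → ℕ}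

namespace MPV

theorem le_refl_s8 (a : MPV) : le a a := Or.inl rfl

theorem le_trans_s8 {a b c : MPV} (hab : le a b) (hbc : le b c) : le a c := by
  cases a <;> cases b <;> cases c <;> simp_all [le]

theorem le_antisymm_s8 {a b : MPV} (hab : le a b) (hba : le b a) : a = b := by
  cases a <;> cases b <;> simp_all [le]

instance : Fintype MPV := ⟨{emp, zero, one, star}, fun x => by cases x <;> simp⟩

theorem card_ne_emp : Nat.card {v : MPV // v ≠ emp} = 3 := by
  rw [Nat.card_eq_fintype_card]
  decide

end MPV

theorem equivalence_iso : Equivalence (Iso (ι := ι) (ar := ar)) where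
  refl G := ⟨id, Function.bijective_id, fun _ _ => rfl⟩
  symm := by
    rintro G H ⟨h, hb, hr⟩
    let e := Equiv.ofBijective h hb
    refine ⟨e.symm, e.symm.bijective, fun i t => ?_⟩
    rw [← hr]
    congr 1
    funext j
    exact e.apply_symm_apply (t j)
  trans := by
    rintro G H K ⟨h, hb, hr⟩ ⟨k, kb, kr⟩
    exact ⟨k ∘ h, kb.comp hb, fun i t => (kr i (h ∘ t)).trans (hr i t)⟩

instance inst_s8 (n k : ℕ) : Finite (CoreRels n k) := by
  unfold CoreRels
  infer_instance

theorem gcount_le (n k : ℕ) : gcount n k ≤ 3 ^ n ^ k := by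
  calc gcount n k ≤ Nat.card (CoreRels n k) :=
        Nat.card_le_card_of_surjective _ Quot.mk_surjective
    _ ≤ Nat.card ((Fin k → Fin n) → {v : MPV // v ≠ MPV.emp}) := by
        refine Nat.card_le_card_of_injective
          (fun f t => ⟨f.1 t, f.2.1 () t⟩) fun f g hfg => Subtype.ext (funext fun t => ?_)
        exact congrArg Subtype.val (congrFun hfg t)
    _ = 3 ^ n ^ k := by
        rw [Nat.card_fun, MPV.card_ne_emp]
        simp

/-- Triples whose neighbouring entries are distinct. -/
abbrev FreeTriple (n : ℕ) : Type := {t : Fin 3 → Fin n // t 0 ≠ t 1 ∧ t 1 ≠ t 2}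

theorem mul_sq_le_card_freeTriple (n : ℕ) : n * (n - 1) ^ 2 ≤ Nat.card (FreeTriple n) := by
  cases n with
  | zero => simp
  | succ k =>
    let φ : Fin (k + 1) × Fin k × Fin k → FreeTriple (k + 1) := fun p =>
      ⟨![p.1.succAbove p.2.1, p.1, p.1.succAbove p.2.2],
        Fin.succAbove_ne _ _, (Fin.succAbove_ne _ _).symm⟩
    have hφ : Function.Injective φ := by
      rintro ⟨b, i, j⟩ ⟨b', i', j'⟩ h
      have h := congrArg Subtype.val h
      have h0 : b.succAbove i = b'.succAbove i' := congrFun h 0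
      have h1 : b = b' := congrFun h 1
      have h2 : b.succAbove j = b'.succAbove j' := congrFun h 2
      subst h1
      simpa using And.intro h0 h2
    have := Nat.card_le_card_of_injective φ hφ
    simpa [Nat.card_eq_fintype_card, Fintype.card_prod, sq] using this

/-- The ternary relation that extends `g` by the value `0` on the diagonal, by `1` on `(x, x, z)`
with `x ≠ z`, and by the strict order of `x` and `z` on `(x, z, z)` with `x ≠ z`. -/
def extendRel {n : ℕ} (g : FreeTriple n → {v : MPV // v ≠ MPV.emp}) (t : Fin 3 → Fin n) : MPV :=
  if h : t 0 ≠ t 1 ∧ t 1 ≠ t 2 then (g ⟨t, h⟩).1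
  else if t 1 = t 2 then (if t 0 < t 1 then MPV.one else MPV.zero)
  else MPV.one

section extendRel

variable {n : ℕ} (g : FreeTriple n → {v : MPV // v ≠ MPV.emp})

theorem extendRel_apply (t : FreeTriple n) : extendRel g t.1 = (g t).1 := dif_pos t.2

theorem extendRel_diag (x : Fin n) : extendRel g (fun _ => x) = MPV.zero := by
  simp [extendRel]

theorem extendRel_left {x z : Fin n} (h : x ≠ z) : extendRel g ![x, x, z] = MPV.one := by
  simp [extendRel, h]

theorem extendRel_right (x z : Fin n) :
    extendRel g ![x, z, z] = if x < z then MPV.one else MPV.zero := by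
  rw [extendRel, dif_neg (fun h => h.2 rfl), if_pos (by simp)]
  rfl

theorem isStar_extendRel : (ofRel n 3 (extendRel g)).isStar := by
  intro _ t
  change extendRel g t ≠ MPV.emp
  unfold extendRel
  split_ifs with h
  · exact (g ⟨t, h⟩).2
  all_goals simp

theorem isCore_extendRel : IsCore (ofRel n 3 (extendRel g)) := by
  intro h hh
  change Fin n → Fin n at h
  refine hh.isIsoMap_of_bijective (Finite.injective_iff_bijective.mp ?_)
  intro (x : Fin n) (z : Fin n) hxz
  by_contra hne
  have h1 : MPV.le (extendRel g ![x, x, z]) (extendRel g (h ∘ ![x, x, z])) := hh () ![x, x, z]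
  have h2 : h ∘ ![x, x, z] = fun _ => h x := by
    funext j
    fin_cases j
    exacts [rfl, rfl, hxz.symm]
  rw [h2, extendRel_left g hne] at h1
  have h3 : extendRel g (fun _ => h x) = MPV.zero := extendRel_diag g (h x)
  rw [h3] at h1
  simp [MPV.le] at h1

/-- The structure `extendRel g` as a core without `⋆` on the diagonal. -/
def extendCore : CoreRels n 3 :=
  ⟨extendRel g, isStar_extendRel g, isCore_extendRel g, fun x => by simp [extendRel_diag]⟩

variable {g}

theorem eq_of_iso_extendRel {g' : FreeTriple n → {v : MPV // v ≠ MPV.emp}}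
    (h : Iso (ofRel n 3 (extendRel g)) (ofRel n 3 (extendRel g'))) : g = g' := by
  obtain ⟨h, hb, hr⟩ := h
  change Fin n → Fin n at h
  have hr : ∀ t : Fin 3 → Fin n, extendRel g' (h ∘ t) = extendRel g t := hr ()
  have hmono : StrictMono h := by
    intro x z hxz
    have h1 := hr ![x, z, z]
    have h2 : h ∘ ![x, z, z] = ![h x, h z, h z] := by
      funext j
      fin_cases j <;> rfl
    rw [h2, extendRel_right, extendRel_right, if_pos hxz] at h1
    by_contra hlt
    simp [hlt] at h1
  have hid : h = id := by
    have := Subsingleton.elim (hmono.orderIsoOfSurjective h hb.2) (OrderIso.refl (Fin n))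
    funext x
    exact congrArg (fun e : Fin n ≃o Fin n => e x) this
  subst hid
  funext t
  have h1 : extendRel g' t.1 = extendRel g t.1 := hr t.1
  rw [extendRel_apply, extendRel_apply] at h1
  exact Subtype.ext h1.symm

end extendRel

theorem le_gcount_three (n : ℕ) : 3 ^ (n * (n - 1) ^ 2) ≤ gcount n 3 := by
  calc 3 ^ (n * (n - 1) ^ 2) ≤ 3 ^ Nat.card (FreeTriple n) :=
        Nat.pow_le_pow_right (by norm_num) (mul_sq_le_card_freeTriple n)
    _ = Nat.card (FreeTriple n → {v : MPV // v ≠ MPV.emp}) := by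
        rw [Nat.card_fun, MPV.card_ne_emp]
    _ ≤ gcount n 3 := by
        refine Nat.card_le_card_of_injective (fun g => Quot.mk _ (extendCore g)) fun g g' hg => ?_
        have hequiv : Equivalence
            (fun a b : CoreRels n 3 => Iso (ofRel n 3 a.1) (ofRel n 3 b.1)) :=
          equivalence_iso.comap fun a : CoreRels n 3 => ofRel n 3 a.1
        exact eq_of_iso_extendRel (hequiv.eqvGen_iff.mp (Quot.eqvGen_exact hg))

/-- for `n ≥ 3` and `m ≥ 1`, if `g₃(n) < g₂(m)` then `m² > n(n-1)² - 1`. -/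
theorem binary_domain_lower_bound (n m : ℕ) (hn : 3 ≤ n) (hm : 1 ≤ m)
    (h : gcount n 3 < gcount m 2) :
    n * (n - 1) ^ 2 - 1 < m ^ 2 := by
  by_contra! hle
  have hpow : 3 ^ m ^ 2 ≤ 3 ^ (n * (n - 1) ^ 2) :=
    Nat.pow_le_pow_right (by norm_num) (hle.trans (Nat.sub_le _ _))
  exact absurd h (not_lt.mpr ((gcount_le m 2).trans (hpow.trans (le_gcount_three n))))
end

section
/- Let H be a 01-graph with nonempty domain. Then Obs_⋆^⊂(H) ≠ Obs_⋆^→(H): there exists a ⋆-graph G that is an inclusion-minimal obstruction for MP_⋆(H) but is not a hom-minimal obstruction for MP_⋆(H). (Concretely, for x ∈ H one may take G on two vertices u, v with E^G(u,u) = E^G(v,v) = E^H(x,x) and E^G(u,v) = E^G(v,u) = ⋆.) -/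
variable {ι : Type} {ar : ι → ℕ}

/-- The `⋆`-graph on two vertices with both loops equal to `e` and both cross values equal
to `⋆`. -/
def starPair (e : MPV) : MPStruct Unit (fun _ => 2) where
  carrier := Bool
  rel := fun _ (t : Fin 2 → Bool) => if t 0 = t 1 then e else MPV.star

/-- Two copies of `α` with value `e` inside each copy, and cross values given by the
identity matrix. -/
def matchingPair (α : Type) [Fintype α] [DecidableEq α] (e : MPV) :
    MPStruct Unit (fun _ => 2) where
  carrier := Bool × α
  rel := fun _ (t : Fin 2 → Bool × α) =>
    if (t 0).1 = (t 1).1 then e else if (t 0).2 = (t 1).2 then MPV.one else MPV.zero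

theorem MPV.not_star_le {a : MPV} (ha : a = MPV.zero ∨ a = MPV.one) :
    ¬ MPV.le MPV.star a := by
  rcases ha with rfl | rfl <;> decide

theorem MPV.eq_of_le {a b : MPV} (hab : MPV.le a b) (ha : a ≠ MPV.emp) (hb : b ≠ MPV.star) :
    a = b := by
  rcases hab with h | h | h
  · exact h
  · exact absurd h ha
  · exact absurd h hb

theorem starPair_isStar {e : MPV} (he : e ≠ MPV.emp) : (starPair e).isStar := by
  intro i t
  simp only [starPair]
  split_ifs
  · exact he
  · decide

theorem not_hom_starPair (e : MPV) {K : MPStruct Unit (fun _ => 2)} (hK : K.is01) :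
    ¬ Hom (starPair e) K := by
  rintro ⟨h, hh⟩
  exact MPV.not_star_le (hK () _) (hh () (![false, true] : Fin 2 → Bool))

theorem hom_delete_starPair (H : MPStruct Unit (fun _ => 2)) (x : H.carrier)
    (v : (starPair (H.rel () fun _ => x)).carrier) :
    Hom ((starPair (H.rel () fun _ => x)).delete v) H := by
  refine ⟨fun _ => x, fun i t => Or.inl ?_⟩
  have key : ∀ a b c : Bool, a ≠ c → b ≠ c → a = b := by decide
  exact if_pos (key _ _ v (t (0 : Fin 2)).2 (t (1 : Fin 2)).2)

section matchingPair

variable {α : Type} [Fintype α] [DecidableEq α]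

theorem matchingPair_is01 {e : MPV} (he : e = MPV.zero ∨ e = MPV.one) :
    (matchingPair α e).is01 := by
  intro i t
  simp only [matchingPair]
  split_ifs
  · exact he
  · exact Or.inr rfl
  · exact Or.inl rfl

theorem matchingPair_hom_starPair (e : MPV) : Hom (matchingPair α e) (starPair e) := by
  refine ⟨Prod.fst, fun i t => ?_⟩
  by_cases hc : (t (0 : Fin 2)).1 = (t (1 : Fin 2)).1
  · exact Or.inl ((if_pos hc).trans (if_pos hc).symm)
  · exact Or.inr (Or.inr (if_neg hc))

/-- A homomorphism to a `01`-graph is injective on each copy of `α`. -/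
theorem injective_of_isHom_matchingPair {e : MPV} {H : MPStruct Unit (fun _ => 2)}
    (hH : H.is01) {h : Bool × α → H.carrier} (hh : IsHom (matchingPair α e) H h) :
    Function.Injective fun a => h (true, a) := by
  intro a b hab
  by_contra hne
  have hstar : ∀ t, H.rel () t ≠ MPV.star := fun t => by
    rcases hH () t with h | h <;> rw [h] <;> decide
  have value : ∀ c, (if a = c then MPV.one else MPV.zero) =
      H.rel () (![h (false, a), h (true, c)] : Fin 2 → H.carrier) := fun c => by
    have hle := hh () (![(false, a), (true, c)] : Fin 2 → Bool × α)
    have hcomp : h ∘ (![(false, a), (true, c)] : Fin 2 → Bool × α) =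
        ![h (false, a), h (true, c)] := by
      ext j; fin_cases j <;> rfl
    rw [← hcomp]
    refine MPV.eq_of_le hle ?_ (hstar _)
    split_ifs <;> decide
  have ha := value a
  have hb := value b
  rw [if_pos rfl] at ha
  rw [if_neg hne, ← show h (true, a) = h (true, b) from hab, ← ha] at hb
  cases hb

theorem not_hom_matchingPair (e : MPV) {H : MPStruct Unit (fun _ => 2)} (hH : H.is01)
    (hcard : Fintype.card H.carrier < Fintype.card α) : ¬ Hom (matchingPair α e) H := by
  rintro ⟨h, hh⟩
  exact hcard.not_ge (Fintype.card_le_of_injective _ (injective_of_isHom_matchingPair hH hh))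

end matchingPair

theorem MPStruct.is01.isStar {G : MPStruct ι ar} (hG : G.is01) : G.isStar := by
  intro i t
  rcases hG i t with h | h <;> rw [h] <;> decide

/-- for every `01`-graph `H` with nonempty domain,
`Obs_⋆^⊂(H) ≠ Obs_⋆^→(H)`: there is a `⋆`-graph that is an inclusion-minimal obstruction
for `MP_⋆(H)` but not a hom-minimal one. -/
theorem inclMin_ne_homMin_star (H : MPStruct Unit (fun _ => 2)) (hH : H.is01)
    (hne : Nonempty H.carrier) :
    ∃ G : MPStruct Unit (fun _ => 2),
      InclMinObs MPStruct.isStar H G ∧ ¬ HomMinObs MPStruct.isStar H G := by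
  obtain ⟨x⟩ := hne
  have he := hH () fun _ => x
  refine ⟨starPair (H.rel () fun _ => x),
    ⟨starPair_isStar (hH.isStar () _), not_hom_starPair _ hH, hom_delete_starPair H x⟩, ?_⟩
  rintro ⟨-, -, -, hmin⟩
  have h01 := matchingPair_is01 (α := Fin (Fintype.card H.carrier + 1)) he
  exact not_hom_matchingPair _ hH (by simp)
    (hmin _ h01.isStar (matchingPair_hom_starPair _) (not_hom_starPair _ h01))
end
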